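/- Let w be a hyperbolic isometry of E = ℝⁿ of maximal reflection length ℓ(w) = n + 1, and for λ ∈ V let t_λ denote the translation x ↦ x + λ. Then for every nonzero λ ∈ V, the translation t_λ lies in the interval [1,w] if and only if λ ∈ Mov(w). -/

import Mathlib

open scoped RealInnerProductSpace

noncomputable section

/-- `n`-dimensional euclidean space `E = ℝⁿ` (also used as the vector space `V` of
translations). -/
abbrev Euc (n : ℕ) := EuclideanSpace ℝ (Fin n)

/-- An isometry of `E`: a surjective distance-preserving map of `E` to itself
(such a map is automatically an affine bijection). -/
abbrev Iso (n : ℕ) := Euc n ≃ᵢ Euc n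

/-- The move-set `Mov(w) = { w(x) - x : x ∈ E } ⊆ V`. -/
def MovSet (n : ℕ) (w : Iso n) : Set (Euc n) := {v | ∃ x, w x - x = v}

/-- The fix-set `Fix(w) = { x ∈ E : w(x) = x }`. -/
def FixSet (n : ℕ) (w : Iso n) : Set (Euc n) := {x | w x = x}

/-- A reflection: a nontrivial isometry fixing pointwise an affine hyperplane,
i.e. a nonempty affine subspace of codimension one. -/
def IsReflection (n : ℕ) (r : Iso n) : Prop :=
  r ≠ 1 ∧ ∃ H : AffineSubspace ℝ (Euc n), (H : Set (Euc n)).Nonempty ∧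
    Module.finrank ℝ H.direction + 1 = n ∧ ∀ x ∈ H, r x = x

/-- The reflection length `ℓ(w)`: the least `k` such that `w` is a product of `k`
reflections. -/
def reflLen (n : ℕ) (w : Iso n) : ℕ :=
  sInf {k | ∃ l : List (Iso n), l.length = k ∧ (∀ r ∈ l, IsReflection n r) ∧ l.prod = w}

/-- `u` lies in the interval `[1, w]`:  `ℓ(u) + ℓ(u⁻¹w) = ℓ(w)`. -/
def inInterval (n : ℕ) (w u : Iso n) : Prop :=
  reflLen n u + reflLen n (u⁻¹ * w) = reflLen n w

/-- The betweenness partial order on the interval `[1, w]`: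
`u ≤ v` iff `ℓ(u) + ℓ(u⁻¹v) + ℓ(v⁻¹w) = ℓ(w)`. -/
def intervalLE (n : ℕ) (w u v : Iso n) : Prop :=
  reflLen n u + reflLen n (u⁻¹ * v) + reflLen n (v⁻¹ * w) = reflLen n w

/-- The set of directions `Dir(S) = { m - m' : m, m' ∈ S }` of a subset `S`. -/
def dirSet (n : ℕ) (S : Set (Euc n)) : Set (Euc n) := {d | ∃ m ∈ S, ∃ m' ∈ S, d = m - m'}

/-- `α` is a root of the reflection `r`: a nonzero vector orthogonal to the
direction space of the fixed hyperplane of `r`. -/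
def IsRoot (n : ℕ) (r : Iso n) (α : Euc n) : Prop :=
  α ≠ 0 ∧ ∀ x y : Euc n, r x = x → r y = y → ⟪α, y - x⟫ = 0

/-- The reflection of `Euc n` whose mirror passes through `p` with normal vector `a`. -/
def reflAt {n : ℕ} (p a : Euc n) : Iso n :=
  IsometryEquiv.addRight p * (Submodule.reflection (ℝ ∙ a)ᗮ).toIsometryEquiv *
    (IsometryEquiv.addRight p)⁻¹

theorem reflAt_apply {n : ℕ} (p a x : Euc n) :
    reflAt p a x = Submodule.reflection (ℝ ∙ a)ᗮ (x - p) + p := by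
  have h : (IsometryEquiv.addRight p)⁻¹ x = x - p := by
    change (IsometryEquiv.addRight p).symm x = x - p
    simp [sub_eq_add_neg]
  simp only [reflAt, IsometryEquiv.mul_apply, h]
  rfl

theorem isReflection_reflAt {n : ℕ} (p : Euc n) {a : Euc n} (ha : a ≠ 0) :
    IsReflection n (reflAt p a) := by
  refine ⟨fun h => ?_, AffineSubspace.mk' p (ℝ ∙ a)ᗮ,
    ⟨p, AffineSubspace.self_mem_mk' _ _⟩, ?_, fun x hx => ?_⟩
  · have h1 : reflAt p a (p + a) = p + a := by rw [h]; rfl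
    rw [reflAt_apply, add_sub_cancel_left,
      Submodule.reflection_orthogonalComplement_singleton_eq_neg, add_comm, add_right_inj] at h1
    have h2 : (2 : ℝ) • a = 0 := by rw [two_smul, ← eq_neg_iff_add_eq_zero, h1]
    exact ha ((smul_eq_zero.1 h2).resolve_left two_ne_zero)
  · rw [AffineSubspace.direction_mk']
    have h1 := (ℝ ∙ a).finrank_add_finrank_orthogonal
    rw [finrank_span_singleton ha, finrank_euclideanSpace_fin] at h1
    omega
  · rw [AffineSubspace.mem_mk', vsub_eq_sub] at hx
    rw [reflAt_apply, Submodule.reflection_mem_subspace_eq_self hx, sub_add_cancel]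

theorem reflLen_prod_le {n : ℕ} (l : List (Iso n)) (hl : ∀ r ∈ l, IsReflection n r) :
    reflLen n l.prod ≤ l.length :=
  Nat.sInf_le ⟨l, rfl, hl, rfl⟩

/-- Every isometry fixing a point is a product of at most `dim (Fix L)ᗮ` reflections, where `L` is
its linear part. -/
theorem exists_reflections_of_fixed {n k : ℕ} (u : Iso n) (p : Euc n) (hp : u p = p)
    (hk : Module.finrank ℝ (ContinuousLinearMap.id ℝ (Euc n) -
      (u.toRealLinearIsometryEquiv : Euc n →L[ℝ] Euc n)).kerᗮ ≤ k) :
    ∃ l : List (Iso n), l.length ≤ k ∧ (∀ r ∈ l, IsReflection n r) ∧ l.prod = u := by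
  obtain ⟨l, hlen, hprod⟩ := u.toRealLinearIsometryEquiv.reflections_generate_dim_aux hk
  have key : ∀ l : List (Euc n), ∃ l' : List (Iso n), l'.length ≤ l.length ∧
      (∀ r ∈ l', IsReflection n r) ∧ ∀ x, l'.prod x =
        (l.map fun v => Submodule.reflection (ℝ ∙ v)ᗮ).prod (x - p) + p := by
    intro l
    induction l with
    | nil => exact ⟨[], le_rfl, by simp, fun x => by simp⟩
    | cons a l ih =>
      obtain ⟨l', h1, h2, h3⟩ := ih
      by_cases ha : a = 0
      · refine ⟨l', h1.trans (by simp), h2, fun x => ?_⟩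
        rw [h3, List.map_cons, List.prod_cons, LinearIsometryEquiv.coe_mul, Function.comp_apply,
          Submodule.reflection_mem_subspace_eq_self (by simp [ha])]
      · refine ⟨reflAt p a :: l', by simpa using h1, ?_, fun x => ?_⟩
        · simpa using ⟨isReflection_reflAt p ha, h2⟩
        · rw [List.prod_cons, IsometryEquiv.mul_apply, h3, reflAt_apply, add_sub_cancel_right,
            List.map_cons, List.prod_cons,
            LinearIsometryEquiv.coe_mul, Function.comp_apply]
  obtain ⟨l', h1, h2, h3⟩ := key l
  refine ⟨l', h1.trans hlen, h2, IsometryEquiv.ext fun x => ?_⟩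
  rw [h3, ← hprod, map_sub, IsometryEquiv.toRealLinearIsometryEquiv_apply,
    IsometryEquiv.toRealLinearIsometryEquiv_apply, hp]
  abel

theorem exists_two_reflections_of_translation {n : ℕ} (t : Iso n) (v : Euc n)
    (ht : ∀ x, t x = x + v) :
    ∃ l : List (Iso n), l.length ≤ 2 ∧ (∀ r ∈ l, IsReflection n r) ∧ l.prod = t := by
  by_cases hv : v = 0
  · exact ⟨[], by simp, by simp, IsometryEquiv.ext fun x => by simp [ht, hv]⟩
  · refine ⟨[reflAt ((2⁻¹ : ℝ) • v) v, reflAt 0 v], le_rfl, ?_, IsometryEquiv.ext fun x => ?_⟩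
    · simpa using ⟨isReflection_reflAt _ hv, isReflection_reflAt _ hv⟩
    · rw [List.prod_cons, List.prod_singleton, IsometryEquiv.mul_apply, reflAt_apply, reflAt_apply,
        ht, sub_zero, add_zero, map_sub, Submodule.reflection_reflection, map_smul,
        Submodule.reflection_orthogonalComplement_singleton_eq_neg]
      module

/-- The kernel of `id - L` has orthogonal complement of dimension at most that of any subspace
containing all displacements of an isometry with linear part `L`. -/
theorem finrank_ker_orthogonal_le {n : ℕ} (L : Euc n →L[ℝ] Euc n) (S : Submodule ℝ (Euc n))
    (hS : ∀ x, L x - x ∈ S) :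
    Module.finrank ℝ (ContinuousLinearMap.id ℝ (Euc n) - L).kerᗮ ≤ Module.finrank ℝ S := by
  have h1 := (ContinuousLinearMap.id ℝ (Euc n) - L).ker.finrank_add_finrank_orthogonal
  have h2 := LinearMap.finrank_range_add_finrank_ker
    (ContinuousLinearMap.id ℝ (Euc n) - L : Euc n →L[ℝ] Euc n).toLinearMap
  have h3 : (ContinuousLinearMap.id ℝ (Euc n) - L : Euc n →L[ℝ] Euc n).toLinearMap.range ≤ S := by
    rintro _ ⟨x, rfl⟩
    have := S.neg_mem (hS x)
    simpa using this
  have h4 := Submodule.finrank_mono h3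
  change _ + Module.finrank ℝ (ContinuousLinearMap.id ℝ (Euc n) - L).ker = _ at h2
  omega

/-- An isometry with linear part `L` is a product of at most `dim (Fix L)ᗮ + 2` reflections. -/
theorem exists_reflections {n k : ℕ} (w : Iso n)
    (hk : Module.finrank ℝ (ContinuousLinearMap.id ℝ (Euc n) -
      (w.toRealLinearIsometryEquiv : Euc n →L[ℝ] Euc n)).kerᗮ ≤ k) :
    ∃ l : List (Iso n), l.length ≤ k + 2 ∧ (∀ r ∈ l, IsReflection n r) ∧ l.prod = w := by
  obtain ⟨l₁, h1, h2, h3⟩ := exists_two_reflections_of_translation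
    (IsometryEquiv.addRight (w 0)) (w 0) (fun x => rfl)
  set u : Iso n := w.toRealLinearIsometryEquiv.toIsometryEquiv with hu
  have hux : ∀ x, u x = w x - w 0 := fun x => w.toRealLinearIsometryEquiv_apply x
  have hlin : u.toRealLinearIsometryEquiv = w.toRealLinearIsometryEquiv := by
    ext1 x
    simp [hux]
  obtain ⟨l₂, h4, h5, h6⟩ := exists_reflections_of_fixed (k := k) u 0 (by simp [hux])
    (by rw [hlin]; exact hk)
  refine ⟨l₁ ++ l₂, by simp; omega, ?_, ?_⟩
  · intro r hr
    rcases List.mem_append.1 hr with h | h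
    exacts [h2 r h, h5 r h]
  · rw [List.prod_append, h3, h6]
    ext1 x
    simp [hux]

theorem exists_length_eq_reflLen {n : ℕ} (w : Iso n) :
    ∃ l : List (Iso n), l.length = reflLen n w ∧ (∀ r ∈ l, IsReflection n r) ∧ l.prod = w := by
  obtain ⟨l, -, h2, h3⟩ := exists_reflections w le_rfl
  exact Nat.sInf_mem (s := {k | ∃ l : List (Iso n), l.length = k ∧
    (∀ r ∈ l, IsReflection n r) ∧ l.prod = w}) ⟨_, l, rfl, h2, h3⟩

theorem reflLen_mul_le {n : ℕ} (u v : Iso n) :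
    reflLen n (u * v) ≤ reflLen n u + reflLen n v := by
  obtain ⟨l₁, h1, h2, h3⟩ := exists_length_eq_reflLen u
  obtain ⟨l₂, h4, h5, h6⟩ := exists_length_eq_reflLen v
  rw [← h1, ← h4, ← List.length_append, ← h3, ← h6, ← List.prod_append]
  refine reflLen_prod_le _ fun r hr => ?_
  rcases List.mem_append.1 hr with h | h
  exacts [h2 r h, h5 r h]

theorem IsReflection.exists_root {n : ℕ} {r : Iso n} (hr : IsReflection n r) :
    ∃ a q : Euc n, (∀ x, r x - x ∈ ℝ ∙ a) ∧ ∀ x, ⟪a, x - q⟫ = 0 → r x = x := by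
  obtain ⟨-, H, ⟨q, hq⟩, hdim, hfix⟩ := hr
  have h1 : Module.finrank ℝ H.directionᗮ = 1 :=
    Submodule.finrank_add_finrank_orthogonal' (by rw [hdim, finrank_euclideanSpace_fin])
  obtain ⟨⟨a, ha⟩, ha0, hspan⟩ := finrank_eq_one_iff'.1 h1
  have hsp : H.directionᗮ = ℝ ∙ a := by
    ext y
    rw [Submodule.mem_span_singleton]
    constructor
    · intro hy
      obtain ⟨c, hc⟩ := hspan ⟨y, hy⟩
      exact ⟨c, congrArg Subtype.val hc⟩
    · rintro ⟨c, rfl⟩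
      exact Submodule.smul_mem _ c ha
  refine ⟨a, q, fun x => ?_, fun x hx => ?_⟩
  · rw [← hsp, Submodule.mem_orthogonal]
    intro h hh
    have hd : ∀ y ∈ H, ‖r x - y‖ = ‖x - y‖ := fun y hy => by
      rw [← dist_eq_norm, ← dist_eq_norm, ← r.dist_eq x y, hfix y hy]
    have e1 := hd q hq
    have e2 := hd (h + q) (AffineSubspace.vadd_mem_of_mem_direction hh hq)
    rw [show r x - (h + q) = (r x - q) - h by abel, show x - (h + q) = (x - q) - h by abel] at e2
    have e3 := norm_sub_sq_real (r x - q) h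
    have e4 := norm_sub_sq_real (x - q) h
    rw [e2, e1] at e3
    have e5 : ⟪r x - q, h⟫ = ⟪x - q, h⟫ := by linarith
    rw [show r x - x = (r x - q) - (x - q) by abel, inner_sub_right, real_inner_comm, e5,
      real_inner_comm, sub_self]
  · apply hfix
    have h2 : x - q ∈ H.directionᗮᗮ := by
      rw [hsp]
      exact Submodule.mem_orthogonal_singleton_iff_inner_right.2 hx
    rw [Submodule.orthogonal_orthogonal] at h2
    simpa using AffineSubspace.vadd_mem_of_mem_direction h2 hq

/-- The displacements of a product of `k` reflections lie in a subspace of dimension at most `k`,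
and in the case of equality the mirrors have a common point. -/
theorem exists_submodule_of_reflections {n : ℕ} (l : List (Iso n))
    (hl : ∀ r ∈ l, IsReflection n r) :
    ∃ S : Submodule ℝ (Euc n), Module.finrank ℝ S ≤ l.length ∧ (∀ x, l.prod x - x ∈ S) ∧
      (l.length ≤ Module.finrank ℝ S → ∃ p, ∀ x, x - p ∈ Sᗮ → l.prod x = x) := by
  induction l with
  | nil => exact ⟨⊥, by simp, by simp, by simp⟩
  | cons r l ih =>
    obtain ⟨S, h1, h2, h3⟩ := ih fun r' hr' => hl r' (List.mem_cons_of_mem r hr')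
    obtain ⟨a, q, ha, hq⟩ := (hl r List.mem_cons_self).exists_root
    refine ⟨S ⊔ ℝ ∙ a, ?_, fun x => ?_, fun hle => ?_⟩
    · have := Submodule.finrank_add_le_finrank_add_finrank S (ℝ ∙ a)
      have := finrank_span_le_card (R := ℝ) ({a} : Set (Euc n))
      rw [Set.toFinset_singleton, Finset.card_singleton] at this
      rw [List.length_cons]
      omega
    · rw [List.prod_cons, IsometryEquiv.mul_apply, ← sub_add_sub_cancel _ (l.prod x) x, add_comm]
      exact Submodule.add_mem_sup (h2 x) (ha _)
    · rw [List.length_cons] at hle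
      have haS : a ∉ S := fun h => by
        rw [sup_eq_left.2 ((Submodule.span_singleton_le_iff_mem _ _).2 h)] at hle
        omega
      have hle' : l.length ≤ Module.finrank ℝ S := by
        have := Submodule.finrank_add_le_finrank_add_finrank S (ℝ ∙ a)
        have := finrank_span_le_card (R := ℝ) ({a} : Set (Euc n))
        rw [Set.toFinset_singleton, Finset.card_singleton] at this
        omega
      obtain ⟨p, hp⟩ := h3 hle'
      have hb := S.sub_starProjection_mem_orthogonal a
      set b := a - S.starProjection a with hb_def
      have hb0 : b ≠ 0 := fun h => haS (by
        rw [sub_eq_zero.1 h]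
        exact Submodule.starProjection_apply_mem S a)
      have hab : ⟪a, b⟫ = ⟪b, b⟫ := by
        have h4 : ⟪S.starProjection a, b⟫ = 0 :=
          Submodule.inner_right_of_mem_orthogonal (Submodule.starProjection_apply_mem S a) hb
        conv_rhs => rw [hb_def, inner_sub_left, ← hb_def, h4, sub_zero]
      have hab0 : ⟪a, b⟫ ≠ 0 := by
        rw [hab]
        exact inner_self_ne_zero.2 hb0
      refine ⟨p + (⟪a, q - p⟫ / ⟪a, b⟫) • b, fun x hx => ?_⟩
      rw [← Submodule.inf_orthogonal, Submodule.mem_inf,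
        Submodule.mem_orthogonal_singleton_iff_inner_right] at hx
      have h5 : l.prod x = x := hp x (by
        have := Sᗮ.add_mem hx.1 (Sᗮ.smul_mem (⟪a, q - p⟫ / ⟪a, b⟫) hb)
        rwa [← sub_sub, sub_add_cancel] at this)
      rw [List.prod_cons, IsometryEquiv.mul_apply, h5]
      apply hq
      have h6 := hx.2
      rw [← sub_sub, inner_sub_right, inner_smul_right, div_mul_cancel₀ _ hab0,
        ← inner_sub_right] at h6
      rw [← h6]
      congr 1
      abel

/-- A translation by a nonzero vector is neither trivial nor a reflection. -/
theorem two_le_reflLen_of_translation {n : ℕ} (t : Iso n) (v : Euc n) (hv : v ≠ 0)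
    (ht : ∀ x, t x = x + v) : 2 ≤ reflLen n t := by
  obtain ⟨l, h1, h2, h3⟩ := exists_length_eq_reflLen t
  rw [← h1]
  have hfix : ∀ x, t x ≠ x := fun x hx => hv (by simpa [ht] using hx)
  match l, h2, h3 with
  | [], _, h3 => exact absurd (by rw [← h3]; rfl) (hfix 0)
  | [r], h2, h3 =>
    obtain ⟨-, H, ⟨q, hq⟩, -, hf⟩ := h2 r (List.mem_singleton_self r)
    rw [List.prod_singleton] at h3
    exact absurd (h3 ▸ hf q hq) (hfix q)
  | _ :: _ :: _, _, _ => simp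

/-- for `w` hyperbolic of maximal reflection length `n + 1` and any
nonzero `λ`, the translation `t_λ : x ↦ x + λ` lies in `[1,w]` iff `λ ∈ Mov(w)`. -/
theorem translation_in_interval_iff (n : ℕ) (w : Iso n)
    (hhyp : (0 : Euc n) ∉ MovSet n w)
    (hlen : reflLen n w = n + 1)
    (lam : Euc n) (hlam : lam ≠ 0)
    (t : Iso n) (ht : ∀ x : Euc n, t x = x + lam) :
    inInterval n w t ↔ lam ∈ MovSet n w := by
  have hinv : ∀ x, (t⁻¹ * w) x = w x - lam := fun x => by
    rw [IsometryEquiv.mul_apply]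
    apply t.injective
    rw [IsometryEquiv.apply_inv_self, ht, sub_add_cancel]
  have hlin : (t⁻¹ * w).toRealLinearIsometryEquiv = w.toRealLinearIsometryEquiv := by
    ext1 x
    simp [hinv]
  have hmem : lam ∈ MovSet n w ↔ ∃ x, (t⁻¹ * w) x = x := by
    simp only [MovSet, Set.mem_ofPred_eq, hinv]
    exact exists_congr fun x => by rw [sub_eq_iff_eq_add, sub_eq_iff_eq_add, add_comm]
  rw [hmem, inInterval, hlen]
  constructor
  · intro hsum
    obtain ⟨l, h1, h2, h3⟩ := exists_length_eq_reflLen (t⁻¹ * w)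
    obtain ⟨S, -, hS, hfix⟩ := exists_submodule_of_reflections l h2
    rw [h3] at hS hfix
    have ht2 := two_le_reflLen_of_translation t lam hlam ht
    have hk := finrank_ker_orthogonal_le
      (w.toRealLinearIsometryEquiv : Euc n →L[ℝ] Euc n) S fun x => by
        have := S.sub_mem (hS x) (hS 0)
        rw [hinv, hinv] at this
        convert! this using 1
        change w.toRealLinearIsometryEquiv x - x = _
        rw [IsometryEquiv.toRealLinearIsometryEquiv_apply]
        abel
    obtain ⟨l', h4, h5, h6⟩ := exists_reflections w hk
    have h7 := reflLen_prod_le l' h5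
    rw [h6, hlen] at h7
    obtain ⟨p, hp⟩ := hfix (by omega)
    exact ⟨p, hp p (by simp)⟩
  · rintro ⟨p, hp⟩
    have hker : (ContinuousLinearMap.id ℝ (Euc n) -
        (w.toRealLinearIsometryEquiv : Euc n →L[ℝ] Euc n)).ker ≠ ⊥ := fun h => by
      obtain ⟨x, hx⟩ := LinearMap.surjective_of_injective (LinearMap.ker_eq_bot.1 h) (w 0)
      refine hhyp ⟨x, ?_⟩
      have hx' : x - (w x - w 0) = w 0 := by simpa using hx
      rw [sub_eq_zero]
      rw [← sub_add, add_eq_right, sub_eq_zero] at hx'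
      exact hx'.symm
    have h1 := Submodule.one_le_finrank_iff.2 hker
    have h2 := (ContinuousLinearMap.id ℝ (Euc n) -
        (w.toRealLinearIsometryEquiv : Euc n →L[ℝ] Euc n)).ker.finrank_add_finrank_orthogonal
    rw [finrank_euclideanSpace_fin] at h2
    obtain ⟨l, h3, h4, h5⟩ := exists_reflections_of_fixed (k := n - 1) (t⁻¹ * w) p hp
      (by rw [hlin]; omega)
    obtain ⟨l', h6, h7, h8⟩ := exists_two_reflections_of_translation t lam ht
    have h9 := reflLen_prod_le l h4
    have h10 := reflLen_prod_le l' h7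
    have h11 := reflLen_mul_le t (t⁻¹ * w)
    rw [mul_inv_cancel_left, hlen] at h11
    rw [h5] at h9
    rw [h8] at h10
    omega
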